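/- Let c>0, let M≥1 and let v=(v_1,…,v_M) be a tuple of smooth functions on (0,∞)×ℝ³. Let Q be one of the null forms Q_0(·,·;c) or Q_{ab} (0≤a<b≤3). Then for every nonnegative integer s there is a constant C_s>0, depending only on c and s, such that for all 1≤j,k≤M and all (t,x) with x≠0, |Q(v_j,v_k)(t,x)|_s ≤ C_s·{ |∂v(t,x)|_{⌊s/2⌋}·Σ_{|α|≤s}|D_{+,c}Z^α v(t,x)| + |∂v(t,x)|_s·Σ_{|α|≤⌊s/2⌋}|D_{+,c}Z^α v(t,x)| + (1/|x|)·( |∂v(t,x)|_{⌊s/2⌋}·|v(t,x)|_{s+1} + |v(t,x)|_{⌊s/2⌋+1}·|∂v(t,x)|_s ) }, where |v|_m=Σ_{i=1}^M |v_i|_m, |∂v|_m=Σ_{i=1}^M Σ_{a=0}^3 |∂_a v_i|_m, and |D_{+,c}Z^α v|=Σ_{i=1}^M |D_{+,c}Z^α v_i|. -/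

import Mathlib

noncomputable section

namespace PaperKatayama

/-- Euclidean 3-space. -/
abbrev E3 := EuclideanSpace ℝ (Fin 3)

/-- Space-time functions. -/
abbrev Fn := ℝ → E3 → ℝ

/-- Functions of the space variable alone. -/
abbrev SFn := E3 → ℝ

/-- The Japanese bracket `⟨a⟩ = √(1+a²)`. -/
def jb (a : ℝ) : ℝ := Real.sqrt (1 + a ^ 2)

/-- Time derivative `∂_t`. -/
def pt (f : Fn) : Fn := fun t x => deriv (fun s => f s x) t

/-- Spatial derivative `∂_j` (j = 1,2,3, here indexed by `Fin 3`). -/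
def pd (j : Fin 3) (f : Fn) : Fn :=
  fun t x => fderiv ℝ (f t) x (EuclideanSpace.single j 1)

/-- `∂_a` for `a ∈ {0,1,2,3}`, with `∂_0 = ∂_t`. -/
def pda (a : Fin 4) : Fn → Fn := Fin.cases pt (fun j => pd j) a

/-- Rotation field `Ω_{jk} = x_j ∂_k − x_k ∂_j`, extended antisymmetrically
(so `rotA k j = − rotA j k`, and `rotA j j = 0`). -/
def rotA (j k : Fin 3) (f : Fn) : Fn :=
  fun t x => x j * pd k f t x - x k * pd j f t x

/-- Radial derivative `∂_r = Σ_j (x_j/r) ∂_j`. -/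
def pr (f : Fn) : Fn := fun t x => ∑ j, (x j / ‖x‖) * pd j f t x

/-- `D_{+,c} = ∂_t + c ∂_r`. -/
def Dp (c : ℝ) (f : Fn) : Fn := fun t x => pt f t x + c * pr f t x

/-- `D_{−,c} = ∂_t − c ∂_r`. -/
def Dm (c : ℝ) (f : Fn) : Fn := fun t x => pt f t x - c * pr f t x

/-- The seven fields `Z = {∂_t, ∂_1, ∂_2, ∂_3, Ω_{12}, Ω_{13}, Ω_{23}}`. -/
def Zop : Fin 7 → Fn → Fn :=
  ![pt, pd 0, pd 1, pd 2, rotA 0 1, rotA 0 2, rotA 1 2]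

/-- `Z^α = Z_1^{α_1} ⋯ Z_7^{α_7}`. -/
def Zpow (α : Fin 7 → ℕ) (f : Fn) : Fn :=
  (Zop 0)^[α 0] <| (Zop 1)^[α 1] <| (Zop 2)^[α 2] <| (Zop 3)^[α 3] <|
    (Zop 4)^[α 4] <| (Zop 5)^[α 5] <| (Zop 6)^[α 6] f

/-- Multi-indices `α` (for the seven fields) with `|α| ≤ s`. -/
def multiIdx (s : ℕ) : Finset (Fin 7 → ℕ) :=
  (Fintype.piFinset fun _ => Finset.range (s + 1)).filter fun α => ∑ i, α i ≤ s

/-- `|v(t,x)|_s = Σ_{|α| ≤ s} |Z^α v(t,x)|`. -/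
def vnorm (s : ℕ) (f : Fn) (t : ℝ) (x : E3) : ℝ :=
  ∑ α ∈ multiIdx s, |Zpow α f t x|

/-- Smoothness of a space-time function. -/
def Smooth (f : Fn) : Prop := ContDiff ℝ (⊤ : ℕ∞) (fun p : ℝ × E3 => f p.1 p.2)

/-- `u` is a smooth solution of `∂_t²u − c²Δu = G` on `(0,∞)×ℝ³`
with zero initial data. -/
def IsWaveSol (c : ℝ) (G u : Fn) : Prop :=
  Smooth u ∧
    (∀ t x, 0 < t → pt (pt u) t x - c ^ 2 * ∑ j, pd j (pd j u) t x = G t x) ∧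
    (∀ x, u 0 x = 0) ∧ (∀ x, pt u 0 x = 0)

/-- `u` is a smooth solution of the free wave equation `∂_t²u − c²Δu = 0`
on `(0,∞)×ℝ³` with initial data `φ, ψ`. -/
def IsFreeWaveSol (c : ℝ) (φ ψ : SFn) (u : Fn) : Prop :=
  Smooth u ∧
    (∀ t x, 0 < t → pt (pt u) t x - c ^ 2 * ∑ j, pd j (pd j u) t x = 0) ∧
    (∀ x, u 0 x = φ x) ∧ (∀ x, pt u 0 x = ψ x)

/-- Extension of the speeds `c_1, …, c_N` by `c_0 = 0`. -/
def cs0 {N : ℕ} (cs : Fin N → ℝ) : Fin (N + 1) → ℝ := Fin.cases 0 cs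

/-- The weight `w(t,r) = min_{0 ≤ j ≤ N} ⟨c_j t − r⟩` (with `c_0 = 0`). -/
def wgt {N : ℕ} (cs : Fin N → ℝ) (t r : ℝ) : ℝ :=
  Finset.univ.inf' Finset.univ_nonempty fun j : Fin (N + 1) => jb (cs0 cs j * t - r)

/-- The weighted sup `A_{ρ,μ,s}[G;c](t,x)` over the backward cone `Λ_c(t,x)`. -/
def Afun (ρ μ : ℝ) (s : ℕ) (G : Fn) (c : ℝ) {N : ℕ} (cs : Fin N → ℝ)
    (t : ℝ) (x : E3) : ℝ :=
  sSup {a : ℝ | ∃ τ : ℝ, ∃ y : E3, 0 ≤ τ ∧ τ ≤ t ∧ ‖y - x‖ ≤ c * (t - τ) ∧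
    a = ‖y‖ * jb (τ + ‖y‖) ^ ρ * wgt cs τ ‖y‖ ^ (1 + μ) * vnorm s G τ y}

/-- Spatial derivative of a function of `x` alone. -/
def sd (j : Fin 3) (φ : SFn) : SFn :=
  fun x => fderiv ℝ φ x (EuclideanSpace.single j 1)

/-- Spatial rotation field for functions of `x` alone. -/
def srot (j k : Fin 3) (φ : SFn) : SFn :=
  fun x => x j * sd k φ x - x k * sd j φ x

/-- The six spatial fields `{∂_1, ∂_2, ∂_3, Ω_{12}, Ω_{13}, Ω_{23}}`. -/
def Sop : Fin 6 → SFn → SFn :=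
  ![sd 0, sd 1, sd 2, srot 0 1, srot 0 2, srot 1 2]

/-- `Z^α` for the spatial fields. -/
def Spow (α : Fin 6 → ℕ) (φ : SFn) : SFn :=
  (Sop 0)^[α 0] <| (Sop 1)^[α 1] <| (Sop 2)^[α 2] <| (Sop 3)^[α 3] <|
    (Sop 4)^[α 4] <| (Sop 5)^[α 5] φ

/-- Spatial multi-indices with `|α| ≤ s`. -/
def smultiIdx (s : ℕ) : Finset (Fin 6 → ℕ) :=
  (Fintype.piFinset fun _ => Finset.range (s + 1)).filter fun α => ∑ i, α i ≤ s

/-- `|φ(x)|_s` for a function of `x` alone. -/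
def snorm (s : ℕ) (φ : SFn) (x : E3) : ℝ :=
  ∑ α ∈ smultiIdx s, |Spow α φ x|

/-- The weighted sup `B_{ρ,s}[φ,ψ;c](t,x)`. -/
def Bfun (ρ : ℝ) (s : ℕ) (φ ψ : SFn) (c t : ℝ) (x : E3) : ℝ :=
  sSup {b : ℝ | ∃ y : E3, ‖y - x‖ ≤ c * t ∧
    b = jb ‖y‖ ^ ρ * (snorm (s + 1) φ y + snorm s ψ y)}

/-- `Φ_ρ(t,r)`. -/
def Phi (ρ t r : ℝ) : ℝ :=
  if ρ = 0 then Real.log (2 + jb (t + r) / jb (t - r)) else jb (t - r) ^ (-ρ)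

/-- `Ψ_ρ(t)`. -/
def Psi (ρ t : ℝ) : ℝ := if ρ = 0 then Real.log (2 + t) else 1

/-- The null form `Q_0(v,w;c) = (∂_t v)(∂_t w) − c²(∇v)·(∇w)`. -/
def Q0f (c : ℝ) (v w : Fn) : Fn :=
  fun t x => pt v t x * pt w t x - c ^ 2 * ∑ j, pd j v t x * pd j w t x

/-- The null form `Q_{ab}(v,w) = (∂_a v)(∂_b w) − (∂_b v)(∂_a w)`. -/
def Qab (a b : Fin 4) (v w : Fn) : Fn :=
  fun t x => pda a v t x * pda b w t x - pda b v t x * pda a w t x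

/-- Lorentz boost `L_{c,j} = (x_j/c)∂_t + c t ∂_j`. -/
def Lb (c : ℝ) (j : Fin 3) (f : Fn) : Fn :=
  fun t x => (x j / c) * pt f t x + c * t * pd j f t x

/-- Scaling field `S = t ∂_t + x·∇_x`. -/
def Sc (f : Fn) : Fn := fun t x => t * pt f t x + ∑ j, x j * pd j f t x

/-- `v(t,r,ω) = r u(t, rω)`. -/
def Vrad (u : Fn) (ω : E3) (t r : ℝ) : ℝ := r * u t (r • ω)

/-- `(∂_t + ∂_r) v` in the variables `(t,r)` for fixed `ω`. -/
def DpV (u : Fn) (ω : E3) (t r : ℝ) : ℝ :=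
  deriv (fun s => Vrad u ω s r) t + deriv (fun ρ' => Vrad u ω t ρ') r

/-- Cross product in ℝ³. -/
def cross3 (a b : Fin 3 → ℝ) : Fin 3 → ℝ :=
  ![a 1 * b 2 - a 2 * b 1, a 2 * b 0 - a 0 * b 2, a 0 * b 1 - a 1 * b 0]

/-- `Ωv = (Ω_{23}v, −Ω_{13}v, Ω_{12}v)`. -/
def OmegaVec (v : Fn) (t : ℝ) (x : E3) : Fin 3 → ℝ :=
  ![rotA 1 2 v t x, -(rotA 0 2 v t x), rotA 0 1 v t x]

/-- `∂^α` for a multi-index with `|α| ≤ 1`: either the identity or a single `∂_a`. -/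
def Dle1 : Option (Fin 4) → Fn → Fn
  | none => id
  | some a => pda a

/-- A linear combination, with constant real coefficients, of the null forms
`Q_0(u_j, ∂^α u_k; c)` and `Q_{ab}(u_j, ∂^α u_k)` with `0 ≤ a < b ≤ 3`, `|α| ≤ 1`. -/
def NullF (c : ℝ) (m : ℕ)
    (a0 : Fin m → Fin m → Fin m → Option (Fin 4) → ℝ)
    (aQ : Fin m → Fin m → Fin m → Fin 4 → Fin 4 → Option (Fin 4) → ℝ)
    (v : Fin m → Fn) (i : Fin m) : Fn := fun t x =>
  (∑ j, ∑ k, ∑ o : Option (Fin 4), a0 i j k o * Q0f c (v j) (Dle1 o (v k)) t x) +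
    ∑ j, ∑ k, ∑ p ∈ Finset.univ.filter (fun p : Fin 4 × Fin 4 => p.1 < p.2),
      ∑ o : Option (Fin 4), aQ i j k p.1 p.2 o * Qab p.1 p.2 (v j) (Dle1 o (v k)) t x


theorem Smooth.mul {f g : Fn} (hf : Smooth f) (hg : Smooth g) : Smooth (f * g) :=
  ContDiff.mul (𝕜 := ℝ) (n := (⊤ : ℕ∞)) hf hg

theorem Smooth.add {f g : Fn} (hf : Smooth f) (hg : Smooth g) : Smooth (f + g) :=
  ContDiff.add (𝕜 := ℝ) (n := (⊤ : ℕ∞)) hf hg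

theorem Smooth.const_smul {f : Fn} (r : ℝ) (hf : Smooth f) : Smooth (r • f) :=
  ContDiff.const_smul (𝕜 := ℝ) (n := (⊤ : ℕ∞)) r hf

/-- The algebra of smooth space-time functions. -/
def smoothAlg : Subalgebra ℝ Fn where
  carrier := {f | Smooth f}
  mul_mem' hf hg := Smooth.mul hf hg
  add_mem' hf hg := Smooth.add hf hg
  algebraMap_mem' r := (contDiff_const : ContDiff ℝ (⊤ : ℕ∞) fun _ : ℝ × E3 => r)

/-- Smooth space-time functions, as a type of its own. -/
def SmoothFn : Type := smoothAlg

instance : CommRing SmoothFn := inferInstanceAs (CommRing smoothAlg)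

instance : Algebra ℝ SmoothFn := inferInstanceAs (Algebra ℝ smoothAlg)

/-- Bundling of a smooth function. -/
def SmoothFn.mk (f : Fn) (hf : Smooth f) : SmoothFn := ⟨f, hf⟩

/-- The underlying function. -/
def SmoothFn.val (f : SmoothFn) : Fn := Subtype.val f

theorem SmoothFn.smooth (f : SmoothFn) : Smooth f.val := Subtype.property f

theorem SmoothFn.ext {f g : SmoothFn} (h : ∀ t x, f.val t x = g.val t x) : f = g :=
  Subtype.ext (funext fun t => funext fun x => h t x)

/-- The space-time direction of `∂_a`. -/
def dir : Fin 4 → ℝ × E3 :=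
  Fin.cases (1, 0) (fun j => (0, EuclideanSpace.single j 1))

theorem Smooth.differentiableAt {f : Fn} (hf : Smooth f) (p : ℝ × E3) :
    DifferentiableAt ℝ (fun p : ℝ × E3 => f p.1 p.2) p :=
  (hf.differentiable (by simp)) p

theorem pda_apply {f : Fn} (hf : Smooth f) (a : Fin 4) (t : ℝ) (x : E3) :
    pda a f t x = fderiv ℝ (fun p : ℝ × E3 => f p.1 p.2) (t, x) (dir a) := by
  have hd := (hf.differentiableAt (t, x)).hasFDerivAt
  induction a using Fin.cases with
  | zero =>
    have h : HasDerivAt (fun s : ℝ => (s, x)) ((1 : ℝ), (0 : E3)) t :=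
      (hasDerivAt_id t).prodMk (hasDerivAt_const t x)
    exact (hd.comp_hasDerivAt t h).deriv
  | succ j =>
    have h : HasFDerivAt (fun y : E3 => (t, y)) (ContinuousLinearMap.inr ℝ ℝ E3) x :=
      hasFDerivAt_prodMk_right t x
    have h' : fderiv ℝ (f t) x = _ := (hd.comp x h).fderiv
    change fderiv ℝ (f t) x (EuclideanSpace.single j 1) = _
    rw [h']
    rfl

theorem Smooth.pda {f : Fn} (hf : Smooth f) (a : Fin 4) : Smooth (pda a f) := by
  have h : (fun p : ℝ × E3 => PaperKatayama.pda a f p.1 p.2) =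
      fun p => fderiv ℝ (fun p : ℝ × E3 => f p.1 p.2) p (dir a) :=
    funext fun p => pda_apply hf a p.1 p.2
  unfold Smooth
  rw [h]
  exact (ContDiff.fderiv_right hf (by norm_cast)).clm_apply contDiff_const

/-- `∂_a` as a derivation of the algebra of smooth functions. -/
def dD (a : Fin 4) : Derivation ℝ SmoothFn SmoothFn :=
  Derivation.mk'
    { toFun := fun f => SmoothFn.mk (pda a f.val) (f.smooth.pda a)
      map_add' := by
        rintro ⟨f, (hf : Smooth f)⟩ ⟨g, (hg : Smooth g)⟩
        refine SmoothFn.ext fun t x => ?_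
        change pda a (f + g) t x = pda a f t x + pda a g t x
        rw [pda_apply hf, pda_apply hg, pda_apply (Smooth.add hf hg), ← add_apply]
        congr 1
        exact fderiv_fun_add (hf.differentiableAt _) (hg.differentiableAt _)
      map_smul' := by
        rintro r ⟨f, (hf : Smooth f)⟩
        refine SmoothFn.ext fun t x => ?_
        change pda a (r • f) t x = r • pda a f t x
        rw [pda_apply hf, pda_apply (Smooth.const_smul r hf), ← smul_apply]
        congr 1
        exact fderiv_fun_const_smul (hf.differentiableAt _) r }
    (by
      rintro ⟨f, (hf : Smooth f)⟩ ⟨g, (hg : Smooth g)⟩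
      refine SmoothFn.ext fun t x => ?_
      change pda a (f * g) t x = f t x * pda a g t x + g t x * pda a f t x
      rw [pda_apply hf, pda_apply hg, pda_apply (Smooth.mul hf hg)]
      have h := fderiv_fun_mul (hf.differentiableAt (t, x)) (hg.differentiableAt (t, x))
      exact congrArg (fun L => L (dir a)) h)

@[simp]
theorem coe_dD (a : Fin 4) (f : SmoothFn) : (dD a f).val = pda a f.val := rfl

theorem dD_comm (a b : Fin 4) (f : SmoothFn) : dD a (dD b f) = dD b (dD a f) := by
  obtain ⟨f, (hf : Smooth f)⟩ := f
  have key (a b : Fin 4) (t : ℝ) (x : E3) : pda a (pda b f) t x =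
      fderiv ℝ (fderiv ℝ (fun p : ℝ × E3 => f p.1 p.2)) (t, x) (dir a) (dir b) := by
    rw [pda_apply (Smooth.pda hf b)]
    have h : (fun p : ℝ × E3 => pda b f p.1 p.2) =
        fun p => fderiv ℝ (fun p : ℝ × E3 => f p.1 p.2) p (dir b) :=
      funext fun p => pda_apply hf b p.1 p.2
    rw [h, fderiv_clm_apply _ (differentiableAt_const _)]
    · simp
    · exact ((ContDiff.fderiv_right (m := 1) hf (by norm_cast)).differentiable (by simp)) _
  refine SmoothFn.ext fun t x => ?_
  change pda a (pda b f) t x = pda b (pda a f) t x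
  rw [key, key]
  have hs : ContDiffAt ℝ (⊤ : ℕ∞) (fun p : ℝ × E3 => f p.1 p.2) (t, x) := ContDiff.contDiffAt hf
  exact (hs.isSymmSndFDerivAt (by simp; norm_cast)).eq _ _

/-- The coordinate functions as smooth functions. -/
def coordS (j : Fin 3) : SmoothFn :=
  SmoothFn.mk (fun _ x => x j) <| by
    change ContDiff ℝ (⊤ : ℕ∞) fun p : ℝ × E3 => p.2 j
    fun_prop

theorem dD_coordS (a : Fin 4) (j : Fin 3) :
    dD a (coordS j) = if a = j.succ then 1 else 0 := by
  refine SmoothFn.ext fun t x => ?_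
  induction a using Fin.cases with
  | zero =>
    have : (0 : Fin 4) ≠ j.succ := (Fin.succ_ne_zero j).symm
    simp only [this, if_false]
    change deriv (fun _ : ℝ => x j) t = 0
    simp
  | succ k =>
    have h : HasFDerivAt (fun y : E3 => y j) (EuclideanSpace.proj j : E3 →L[ℝ] ℝ) x :=
      (EuclideanSpace.proj j : E3 →L[ℝ] ℝ).hasFDerivAt
    change fderiv ℝ (fun y : E3 => y j) x (EuclideanSpace.single k 1) = _
    rw [h.fderiv]
    by_cases hk : k = j
    · subst hk
      simp
      rfl
    · have : j ≠ k := fun h => hk h.symm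
      simp [hk, this]
      rfl

/-- `Ω_{jk}` as a derivation of the algebra of smooth functions. -/
def rotD (j k : Fin 3) : Derivation ℝ SmoothFn SmoothFn :=
  coordS j • dD k.succ - coordS k • dD j.succ

theorem rotD_apply (j k : Fin 3) (f : SmoothFn) :
    rotD j k f = coordS j * dD k.succ f - coordS k * dD j.succ f := rfl

/-- Structure constants of the commutators of partial derivatives with rotations. -/
def eps (a : Fin 4) (j : Fin 3) : ℝ := if a = j.succ then 1 else 0

theorem dD_coordS_eq_smul (a : Fin 4) (j : Fin 3) : dD a (coordS j) = eps a j • 1 := by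
  rw [dD_coordS, eps]
  split_ifs <;> simp

theorem dD_rotD (a : Fin 4) (j k : Fin 3) (f : SmoothFn) :
    dD a (rotD j k f) =
      rotD j k (dD a f) + (eps a j • dD k.succ f - eps a k • dD j.succ f) := by
  simp only [rotD_apply, map_sub, Derivation.leibniz, dD_coordS_eq_smul, smul_eq_mul,
    mul_smul_comm, mul_one, dD_comm a]
  ring

theorem eps_succ_comm (j k : Fin 3) : eps j.succ k = eps k.succ j := by
  simp [eps, eq_comm]

theorem rotD_comm (j k l m : Fin 3) (f : SmoothFn) :
    rotD j k (rotD l m f) - rotD l m (rotD j k f) =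
      eps k.succ l • rotD j m f - eps j.succ l • rotD k m f
        - eps k.succ m • rotD j l f + eps j.succ m • rotD k l f := by
  have h (u v : Fin 3) (g : SmoothFn) :
    rotD u v g = coordS u * dD v.succ g - coordS v * dD u.succ g := rfl
  rw [h j k (rotD l m f), dD_rotD, dD_rotD]
  simp only [rotD_apply, map_sub, Derivation.leibniz, dD_coordS_eq_smul, smul_eq_mul,
    mul_one, dD_comm m.succ, dD_comm l.succ, Algebra.smul_def,
    eps_succ_comm l, eps_succ_comm m]
  ring

/-- The ordered monomial with exponents `α`. -/
def ordMono {A : Type*} [Monoid A] (Z : Fin 7 → A) (α : Fin 7 → ℕ) : A :=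
  Z 0 ^ α 0 * (Z 1 ^ α 1 * (Z 2 ^ α 2 * (Z 3 ^ α 3 * (Z 4 ^ α 4 * (Z 5 ^ α 5 * Z 6 ^ α 6)))))

/-- The list with letters in increasing order and multiplicities `α`. -/
def ordList (α : Fin 7 → ℕ) : List (Fin 7) :=
  List.replicate (α 0) 0 ++ (List.replicate (α 1) 1 ++ (List.replicate (α 2) 2 ++
    (List.replicate (α 3) 3 ++ (List.replicate (α 4) 4 ++ (List.replicate (α 5) 5 ++
      List.replicate (α 6) 6)))))

theorem prod_map_ordList {A : Type*} [Monoid A] (Z : Fin 7 → A) (α : Fin 7 → ℕ) :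
    ((ordList α).map Z).prod = ordMono Z α := by
  simp [ordList, ordMono]

theorem length_ordList (α : Fin 7 → ℕ) : (ordList α).length = ∑ i, α i := by
  simp [ordList, Fin.sum_univ_seven, add_assoc]

theorem perm_ordList_count (L : List (Fin 7)) : L.Perm (ordList fun i => L.count i) := by
  rw [List.perm_iff_count]
  intro i
  fin_cases i <;> simp [ordList, List.count_replicate]

theorem mem_multiIdx {s : ℕ} {α : Fin 7 → ℕ} : α ∈ multiIdx s ↔ ∑ i, α i ≤ s := by
  simp only [multiIdx, Finset.mem_filter, Fintype.mem_piFinset, Finset.mem_range,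
    and_iff_right_iff_imp]
  intro h i
  exact Nat.lt_succ_of_le ((Finset.single_le_sum (fun _ _ => Nat.zero_le _)
    (Finset.mem_univ i)).trans h)

section Words

variable {A ι : Type*} [Ring A] [Algebra ℝ A]

/-- The span of all words of length at most `n` in the letters `Z i`. -/
def wordSpan (Z : ι → A) (n : ℕ) : Submodule ℝ A :=
  Submodule.span ℝ {T | ∃ L : List ι, L.length ≤ n ∧ (L.map Z).prod = T}

theorem word_mem_wordSpan (Z : ι → A) {n : ℕ} {L : List ι} (h : L.length ≤ n) :
    (L.map Z).prod ∈ wordSpan Z n :=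
  Submodule.subset_span ⟨L, h, rfl⟩

theorem wordSpan_mono (Z : ι → A) {m n : ℕ} (h : m ≤ n) : wordSpan Z m ≤ wordSpan Z n :=
  Submodule.span_mono fun _ ⟨L, hL, hT⟩ => ⟨L, hL.trans h, hT⟩

theorem letter_mul_mem_wordSpan (Z : ι → A) (i : ι) {n : ℕ} {T : A} (hT : T ∈ wordSpan Z n) :
    Z i * T ∈ wordSpan Z (n + 1) := by
  induction hT using Submodule.span_induction with
  | mem T h =>
    obtain ⟨L, hL, rfl⟩ := h
    exact Submodule.subset_span ⟨i :: L, by simpa using hL, by simp⟩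
  | zero => simp
  | add S T _ _ hS hT => rw [mul_add]; exact add_mem hS hT
  | smul r T _ hT => rw [mul_smul_comm]; exact Submodule.smul_mem _ _ hT

theorem span_mul_word_mem_wordSpan (Z : ι → A) {n : ℕ} {L : List ι} (hL : L.length ≤ n) {S : A}
    (hS : S ∈ Submodule.span ℝ (Set.range Z)) : S * (L.map Z).prod ∈ wordSpan Z (n + 1) := by
  induction hS using Submodule.span_induction with
  | mem S h =>
    obtain ⟨i, rfl⟩ := h
    exact letter_mul_mem_wordSpan Z i (word_mem_wordSpan Z hL)
  | zero => simp
  | add S T _ _ hS hT => rw [add_mul]; exact add_mem hS hT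
  | smul r T _ hT => rw [smul_mul_assoc]; exact Submodule.smul_mem _ _ hT

/-- If the commutators of letters are linear combinations of letters, then permuting the letters
of a word changes it by a combination of shorter words. -/
theorem word_sub_word_mem_wordSpan_of_perm (Z : ι → A)
    (hZ : ∀ i j, Z i * Z j - Z j * Z i ∈ Submodule.span ℝ (Set.range Z)) {L L' : List ι}
    (h : L.Perm L') : ∀ n, L.length ≤ n + 1 →
      (L.map Z).prod - (L'.map Z).prod ∈ wordSpan Z n := by
  induction h with
  | nil => intro n _; simp
  | @cons i L L' h ih =>
    intro n hn
    simp only [List.length_cons, Nat.add_le_add_iff_right] at hn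
    simp only [List.map_cons, List.prod_cons, ← mul_sub]
    cases n with
    | zero =>
      obtain rfl : L = [] := by simpa using hn
      obtain rfl : L' = [] := by simpa using h
      simp
    | succ m => exact letter_mul_mem_wordSpan Z i (ih m hn)
  | swap i j L =>
    intro n hn
    simp only [List.length_cons, Nat.add_le_add_iff_right] at hn
    simp only [List.map_cons, List.prod_cons, ← mul_assoc, ← sub_mul]
    obtain ⟨m, rfl⟩ : ∃ m, n = m + 1 := ⟨n - 1, by omega⟩
    exact span_mul_word_mem_wordSpan Z (by omega) (hZ j i)
  | @trans L₁ L₂ L₃ h _ ih ih' =>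
    intro n hn
    rw [← sub_add_sub_cancel _ (L₂.map Z).prod]
    exact add_mem (ih n hn) (ih' n (h.length_eq ▸ hn))

theorem wordSpan_le_span_ordMono (Z : Fin 7 → A)
    (hZ : ∀ i j, Z i * Z j - Z j * Z i ∈ Submodule.span ℝ (Set.range Z)) (n : ℕ) :
    wordSpan Z n ≤ Submodule.span ℝ (ordMono Z '' multiIdx n) := by
  have hord (L : List (Fin 7)) (n : ℕ) (hL : L.length ≤ n) :
      ordMono Z (fun i => L.count i) ∈ Submodule.span ℝ (ordMono Z '' multiIdx n) := by
    refine Submodule.subset_span ⟨_, ?_, rfl⟩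
    rw [Finset.mem_coe, mem_multiIdx, ← length_ordList, ← (perm_ordList_count L).length_eq]
    exact hL
  induction n with
  | zero =>
    refine Submodule.span_le.2 ?_
    rintro _ ⟨L, hL, rfl⟩
    obtain rfl : L = [] := by simpa using hL
    simpa [ordMono] using hord [] 0 le_rfl
  | succ n ih =>
    refine Submodule.span_le.2 ?_
    rintro _ ⟨L, hL, rfl⟩
    have h := ih (word_sub_word_mem_wordSpan_of_perm Z hZ (perm_ordList_count L) n hL)
    rw [prod_map_ordList] at h
    have hsub : ordMono Z '' (multiIdx n : Set (Fin 7 → ℕ)) ⊆ ordMono Z '' multiIdx (n + 1) :=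
      Set.image_mono fun α hα => by
        rw [Finset.mem_coe, mem_multiIdx] at hα ⊢
        omega
    simpa using add_mem (Submodule.span_mono hsub h) (hord L (n + 1) hL)

end Words

/-- The seven fields as derivations of the algebra of smooth functions. -/
def fieldD : Fin 7 → Derivation ℝ SmoothFn SmoothFn :=
  ![dD 0, dD 1, dD 2, dD 3, rotD 0 1, rotD 0 2, rotD 1 2]

/-- A derivation of the algebra of smooth functions as a linear operator. -/
def toEnd (D : Derivation ℝ SmoothFn SmoothFn) : Module.End ℝ SmoothFn :=
  (D : SmoothFn →ₗ[ℝ] SmoothFn)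

/-- The seven fields as linear operators on smooth functions. -/
def fieldE (i : Fin 7) : Module.End ℝ SmoothFn := toEnd (fieldD i)

@[simp]
theorem fieldE_apply (i : Fin 7) (f : SmoothFn) : fieldE i f = fieldD i f := rfl

theorem coe_fieldE (i : Fin 7) (f : SmoothFn) : (fieldE i f).val = Zop i f.val := by
  fin_cases i <;> rfl

theorem coe_fieldE_pow (i : Fin 7) (n : ℕ) (f : SmoothFn) :
    ((fieldE i ^ n) f).val = (Zop i)^[n] f.val := by
  induction n with
  | zero => simp
  | succ n ih => rw [pow_succ', Module.End.mul_apply, coe_fieldE, ih, Function.iterate_succ_apply']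

theorem coe_ordMono (α : Fin 7 → ℕ) (f : SmoothFn) :
    (ordMono fieldE α f).val = Zpow α f.val := by
  simp only [ordMono, Module.End.mul_apply, coe_fieldE_pow, Zpow]

theorem fieldD_cases (i : Fin 7) :
    (∃ a, fieldD i = dD a) ∨ ∃ j k, fieldD i = rotD j k := by
  fin_cases i
  exacts [.inl ⟨0, rfl⟩, .inl ⟨1, rfl⟩, .inl ⟨2, rfl⟩, .inl ⟨3, rfl⟩, .inr ⟨0, 1, rfl⟩,
    .inr ⟨0, 2, rfl⟩, .inr ⟨1, 2, rfl⟩]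

theorem dD_mem_span (a : Fin 4) :
    toEnd (dD a) ∈ Submodule.span ℝ (Set.range fieldE) := by
  fin_cases a
  exacts [Submodule.subset_span ⟨0, rfl⟩, Submodule.subset_span ⟨1, rfl⟩,
    Submodule.subset_span ⟨2, rfl⟩, Submodule.subset_span ⟨3, rfl⟩]

theorem rotD_swap (j k : Fin 3) : rotD k j = -rotD j k := by
  simp only [rotD, neg_sub]

theorem rotD_mem_span (j k : Fin 3) :
    toEnd (rotD j k) ∈ Submodule.span ℝ (Set.range fieldE) := by
  have hlt (j k : Fin 3) (h : j < k) :
      toEnd (rotD j k) ∈ Submodule.span ℝ (Set.range fieldE) := by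
    fin_cases j <;> fin_cases k <;> simp at h
    exacts [Submodule.subset_span ⟨4, rfl⟩, Submodule.subset_span ⟨5, rfl⟩,
      Submodule.subset_span ⟨6, rfl⟩]
  rcases lt_trichotomy j k with h | rfl | h
  · exact hlt j k h
  · have : toEnd (rotD j j) = 0 := by simp only [rotD, sub_self]; rfl
    rw [this]
    exact zero_mem _
  · have : toEnd (rotD j k) = -toEnd (rotD k j) := by
      rw [rotD_swap k j]; rfl
    rw [this]
    exact neg_mem (hlt k j h)

theorem fieldE_commutator_mem_span (i j : Fin 7) :
    fieldE i * fieldE j - fieldE j * fieldE i ∈ Submodule.span ℝ (Set.range fieldE) := by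
  have hdr (a : Fin 4) (j k : Fin 3) :
      toEnd (dD a) * toEnd (rotD j k)
        - toEnd (rotD j k) * toEnd (dD a)
      ∈ Submodule.span ℝ (Set.range fieldE) := by
    have : toEnd (dD a) * toEnd (rotD j k)
        - toEnd (rotD j k) * toEnd (dD a) =
        eps a j • toEnd (dD k.succ)
          - eps a k • toEnd (dD j.succ) := by
      refine LinearMap.ext fun f => ?_
      exact sub_eq_iff_eq_add'.2 (dD_rotD a j k f)
    rw [this]
    exact sub_mem (Submodule.smul_mem _ _ (dD_mem_span _)) (Submodule.smul_mem _ _ (dD_mem_span _))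
  unfold fieldE
  rcases fieldD_cases i with ⟨a, ha⟩ | ⟨l, m, ha⟩ <;>
    rcases fieldD_cases j with ⟨b, hb⟩ | ⟨p, q, hb⟩ <;> rw [ha, hb]
  · have : toEnd (dD a) * toEnd (dD b)
        - toEnd (dD b) * toEnd (dD a) = 0 :=
      LinearMap.ext fun f => sub_eq_zero.2 (dD_comm a b f)
    rw [this]
    exact zero_mem _
  · exact hdr a p q
  · rw [← neg_sub]
    exact neg_mem (hdr b l m)
  · have : toEnd (rotD l m) * toEnd (rotD p q)
        - toEnd (rotD p q) * toEnd (rotD l m) =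
        eps m.succ p • toEnd (rotD l q)
          - eps l.succ p • toEnd (rotD m q)
          - eps m.succ q • toEnd (rotD l p)
          + eps l.succ q • toEnd (rotD m p) :=
      LinearMap.ext fun f => rotD_comm l m p q f
    rw [this]
    exact add_mem (sub_mem (sub_mem (Submodule.smul_mem _ _ (rotD_mem_span _ _))
      (Submodule.smul_mem _ _ (rotD_mem_span _ _))) (Submodule.smul_mem _ _ (rotD_mem_span _ _)))
      (Submodule.smul_mem _ _ (rotD_mem_span _ _))

/-- The operator given by a word in the seven fields. -/
def word (L : List (Fin 7)) : Module.End ℝ SmoothFn := (L.map fieldE).prod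

@[simp]
theorem word_nil (f : SmoothFn) : word [] f = f := rfl

theorem word_cons (i : Fin 7) (L : List (Fin 7)) (f : SmoothFn) :
    word (i :: L) f = fieldD i (word L f) := by
  simp [word]

theorem word_concat (i : Fin 7) (L : List (Fin 7)) (f : SmoothFn) :
    word (L ++ [i]) f = word L (fieldD i f) := by
  simp [word]

theorem exists_bound_of_mem_wordSpan {T : Module.End ℝ SmoothFn} {n : ℕ}
    (hT : T ∈ wordSpan fieldE n) :
    ∃ C : ℝ, 0 ≤ C ∧ ∀ (l : SmoothFn →ₗ[ℝ] ℝ) (f : SmoothFn),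
      |l (T f)| ≤ C * ∑ α ∈ multiIdx n, |l (ordMono fieldE α f)| := by
  have h := wordSpan_le_span_ordMono fieldE fieldE_commutator_mem_span n hT
  clear hT
  induction h using Submodule.span_induction with
  | mem T h =>
    obtain ⟨α, hα, rfl⟩ := h
    refine ⟨1, zero_le_one, fun l f => ?_⟩
    rw [one_mul]
    exact Finset.single_le_sum (f := fun α => |l (ordMono fieldE α f)|)
      (fun _ _ => abs_nonneg _) hα
  | zero => exact ⟨0, le_rfl, fun l f => by simp⟩
  | add S T _ _ hS hT =>
    obtain ⟨C, hC, hS⟩ := hS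
    obtain ⟨D, hD, hT⟩ := hT
    refine ⟨C + D, add_nonneg hC hD, fun l f => ?_⟩
    rw [LinearMap.add_apply, map_add, add_mul]
    exact (abs_add_le _ _).trans (add_le_add (hS l f) (hT l f))
  | smul r T _ hT =>
    obtain ⟨C, hC, hT⟩ := hT
    refine ⟨|r| * C, mul_nonneg (abs_nonneg _) hC, fun l f => ?_⟩
    rw [LinearMap.smul_apply, map_smul, smul_eq_mul, abs_mul, mul_assoc]
    exact mul_le_mul_of_nonneg_left (hT l f) (abs_nonneg _)

theorem sum_eps_smul_dD (k : Fin 3) (f : SmoothFn) :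
    ∑ d, eps d k • dD d f = dD k.succ f := by
  simp [eps, ite_smul]

theorem exists_dD_fieldD (i : Fin 7) (a : Fin 4) :
    ∃ m : Fin 4 → ℝ, ∀ f, dD a (fieldD i f) = fieldD i (dD a f) + ∑ d, m d • dD d f := by
  rcases fieldD_cases i with ⟨b, hb⟩ | ⟨j, k, hb⟩ <;> rw [hb]
  · exact ⟨0, fun f => by simp [dD_comm a b]⟩
  · refine ⟨fun d => eps a j * eps d k - eps a k * eps d j, fun f => ?_⟩
    simp only [dD_rotD, sub_smul, mul_smul, Finset.sum_sub_distrib, ← Finset.smul_sum,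
      sum_eps_smul_dD]

theorem exists_dD_word (L : List (Fin 7)) : ∀ a : Fin 4,
    ∃ T : Fin 4 → Module.End ℝ SmoothFn, (∀ b, T b ∈ wordSpan fieldE L.length) ∧
      ∀ f, dD a (word L f) = ∑ b, T b (dD b f) := by
  induction L with
  | nil =>
    refine fun a => ⟨fun b => if b = a then 1 else 0, fun b => ?_, fun f => ?_⟩
    · dsimp only
      split_ifs
      · exact Submodule.subset_span ⟨[], by simp⟩
      · exact zero_mem _
    · simp [DFunLike.ite_apply]
  | cons i L ih =>
    intro a
    choose T hT hTf using ih
    obtain ⟨m, hm⟩ := exists_dD_fieldD i a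
    refine ⟨fun b => fieldE i * T a b + ∑ d, m d • T d b, fun b => ?_, fun f => ?_⟩
    · exact add_mem (letter_mul_mem_wordSpan _ _ (hT a b)) (sum_mem fun d _ =>
        Submodule.smul_mem _ _ (wordSpan_mono _ (Nat.le_succ _) (hT d b)))
    · simp only [word_cons, hm, hTf, map_sum, LinearMap.add_apply, Module.End.mul_apply,
        fieldE_apply, LinearMap.sum_apply, LinearMap.smul_apply, Finset.sum_add_distrib,
        Finset.smul_sum]
      congr 1
      exact Finset.sum_comm

theorem exists_bound_dD_word (a : Fin 4) {L : List (Fin 7)} {n : ℕ} (hL : L.length ≤ n) :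
    ∃ C : ℝ, 0 ≤ C ∧ ∀ (l : SmoothFn →ₗ[ℝ] ℝ) (f : SmoothFn),
      |l (dD a (word L f))| ≤ C * ∑ b, ∑ α ∈ multiIdx n, |l (ordMono fieldE α (dD b f))| := by
  obtain ⟨T, hT, hTf⟩ := exists_dD_word L a
  choose C hC hCf using fun b => exists_bound_of_mem_wordSpan (wordSpan_mono _ hL (hT b))
  refine ⟨∑ b, C b, Finset.sum_nonneg fun b _ => hC b, fun l f => ?_⟩
  rw [hTf, map_sum, Finset.mul_sum]
  refine (Finset.abs_sum_le_sum_abs _ _).trans (Finset.sum_le_sum fun b _ => ?_)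
  exact (hCf b l _).trans (mul_le_mul_of_nonneg_right
    (Finset.single_le_sum (fun b _ => hC b) (Finset.mem_univ b))
    (Finset.sum_nonneg fun _ _ => abs_nonneg _))

/-- The null forms on smooth functions: `Q_0` for `none`, `Q_{ab}` for `some (a, b)`. -/
def nullS (c : ℝ) : Option (Fin 4 × Fin 4) → SmoothFn → SmoothFn → SmoothFn
  | none, v, w => dD 0 v * dD 0 w - c ^ 2 • ∑ j : Fin 3, dD j.succ v * dD j.succ w
  | some (a, b), v, w => dD a v * dD b w - dD b v * dD a w

theorem sum_eps_succ_smul (k : Fin 3) (F : Fin 3 → SmoothFn) :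
    ∑ j : Fin 3, eps j.succ k • F j = F k := by
  simp [eps, ite_smul]

theorem exists_fieldD_nullS (c : ℝ) (i : Fin 7) (q : Option (Fin 4 × Fin 4)) :
    ∃ m : Fin 4 × Fin 4 → ℝ, ∀ v w, fieldD i (nullS c q v w) =
      nullS c q (fieldD i v) w + nullS c q v (fieldD i w) + ∑ p, m p • nullS c (some p) v w := by
  rcases q with _ | ⟨a, b⟩
  · refine ⟨0, fun v w => ?_⟩
    simp only [Pi.zero_apply, zero_smul, Finset.sum_const_zero, add_zero]
    rcases fieldD_cases i with ⟨b, hb⟩ | ⟨j, k, hb⟩ <;> rw [hb]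
    · simp only [nullS, map_sub, Derivation.leibniz, Derivation.map_smul, map_sum, dD_comm b,
        smul_eq_mul, Finset.sum_add_distrib]
      simp only [Algebra.smul_def, mul_comm (dD _ w)]
      ring
    · have h0 (j : Fin 3) : eps 0 j = 0 := if_neg (Fin.succ_ne_zero j).symm
      have hR (a : Fin 4) (f : SmoothFn) : rotD j k (dD a f) =
          dD a (rotD j k f) - (eps a j • dD k.succ f - eps a k • dD j.succ f) :=
        eq_sub_of_add_eq (dD_rotD a j k f).symm
      simp only [nullS, map_sub, Derivation.leibniz, Derivation.map_smul, map_sum, hR,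
        smul_eq_mul, mul_sub, Finset.sum_add_distrib, Finset.sum_sub_distrib,
        mul_smul_comm, sum_eps_succ_smul, h0, zero_smul]
      simp only [Algebra.smul_def, mul_comm (dD _ w)]
      ring
  · obtain ⟨m, hm⟩ := exists_dD_fieldD i a
    obtain ⟨n, hn⟩ := exists_dD_fieldD i b
    refine ⟨fun p => -((if p.2 = b then m p.1 else 0) + if p.1 = a then n p.2 else 0),
      fun v w => ?_⟩
    have hm' (f : SmoothFn) : fieldD i (dD a f) = dD a (fieldD i f) - ∑ d, m d • dD d f :=
      eq_sub_of_add_eq (hm f).symm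
    have hn' (f : SmoothFn) : fieldD i (dD b f) = dD b (fieldD i f) - ∑ d, n d • dD d f :=
      eq_sub_of_add_eq (hn f).symm
    have hsum : ∑ p : Fin 4 × Fin 4,
          -((if p.2 = b then m p.1 else 0) + if p.1 = a then n p.2 else 0) •
            nullS c (some p) v w =
        -((∑ d, m d • dD d v) * dD b w - dD b v * ∑ d, m d • dD d w)
          - (dD a v * (∑ d, n d • dD d w) - (∑ d, n d • dD d v) * dD a w) := by
      have h₁ : ∑ p : Fin 4 × Fin 4, (if p.2 = b then m p.1 else 0) • nullS c (some p) v w =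
          ∑ d, m d • nullS c (some (d, b)) v w := by
        simp [Fintype.sum_prod_type, ite_smul]
      have h₂ : ∑ p : Fin 4 × Fin 4, (if p.1 = a then n p.2 else 0) • nullS c (some p) v w =
          ∑ d, n d • nullS c (some (a, d)) v w := by
        simp [Fintype.sum_prod_type_right, ite_smul]
      simp only [neg_smul, add_smul, Finset.sum_neg_distrib, Finset.sum_add_distrib, h₁, h₂]
      simp only [nullS, smul_sub, Finset.sum_sub_distrib, Finset.sum_mul, Finset.mul_sum,
        smul_mul_assoc, mul_smul_comm]
      ring
    rw [hsum]
    simp only [nullS, map_sub, Derivation.leibniz, hm', hn', smul_eq_mul]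
    ring

/-- Evaluation at a space-time point. -/
def evalS (t : ℝ) (x : E3) : SmoothFn →ₗ[ℝ] ℝ where
  toFun f := f.val t x
  map_add' _ _ := rfl
  map_smul' _ _ := rfl

theorem evalS_apply (t : ℝ) (x : E3) (f : SmoothFn) : evalS t x f = f.val t x := rfl

theorem evalS_mul (t : ℝ) (x : E3) (f g : SmoothFn) :
    evalS t x (f * g) = evalS t x f * evalS t x g := rfl

/-- Evaluation of `D_{+,c}` at a space-time point. -/
def evalDp (c t : ℝ) (x : E3) : SmoothFn →ₗ[ℝ] ℝ :=
  evalS t x ∘ₗ toEnd (dD 0) +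
    c • ∑ j : Fin 3, (x j / ‖x‖) • (evalS t x ∘ₗ toEnd (dD j.succ))

theorem evalDp_apply (c t : ℝ) (x : E3) (f : SmoothFn) :
    evalDp c t x f = evalS t x (dD 0 f) + c * ∑ j, (x j / ‖x‖) * evalS t x (dD j.succ f) := by
  simp [evalDp, toEnd]

theorem evalDp_eq_Dp (c t : ℝ) (x : E3) (f : SmoothFn) :
    evalDp c t x f = Dp c f.val t x := by
  rw [evalDp_apply]
  rfl

/-- The size of the gradient at a point. -/
def gradAt (t : ℝ) (x : E3) (f : SmoothFn) : ℝ := ∑ a, |evalS t x (dD a f)|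

/-- The size of the rotational derivatives at a point. -/
def rotAt (t : ℝ) (x : E3) (f : SmoothFn) : ℝ :=
  |evalS t x (rotD 0 1 f)| + |evalS t x (rotD 0 2 f)| + |evalS t x (rotD 1 2 f)|

theorem abs_le_gradAt (t : ℝ) (x : E3) (f : SmoothFn) (a : Fin 4) :
    |evalS t x (dD a f)| ≤ gradAt t x f :=
  Finset.single_le_sum (f := fun a => |evalS t x (dD a f)|) (fun _ _ => abs_nonneg _)
    (Finset.mem_univ a)

theorem gradAt_nonneg (t : ℝ) (x : E3) (f : SmoothFn) : 0 ≤ gradAt t x f :=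
  Finset.sum_nonneg fun _ _ => abs_nonneg _

theorem rotAt_nonneg (t : ℝ) (x : E3) (f : SmoothFn) : 0 ≤ rotAt t x f := by
  unfold rotAt
  positivity

/-- The covector along which the gradient points up to tangential derivatives. -/
def nullCovec (c : ℝ) (x : E3) : Fin 4 → ℝ := Fin.cons 1 fun j => -(x j / ‖x‖) / c

theorem sum_sq_direction {x : E3} (hx : x ≠ 0) : ∑ j, (x j / ‖x‖) ^ 2 = 1 := by
  have h : ‖x‖ ≠ 0 := norm_ne_zero_iff.2 hx
  simp only [div_pow, ← Finset.sum_div]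
  rw [← EuclideanSpace.real_norm_sq_eq]
  exact div_self (pow_ne_zero 2 h)

theorem abs_direction_le_one {x : E3} (hx : x ≠ 0) (j : Fin 3) : |x j / ‖x‖| ≤ 1 := by
  rw [← sq_le_one_iff_abs_le_one, ← sum_sq_direction hx]
  exact Finset.single_le_sum (f := fun j => (x j / ‖x‖) ^ 2) (fun _ _ => sq_nonneg _)
    (Finset.mem_univ j)

theorem abs_nullCovec_le {c : ℝ} (hc : 0 < c) {x : E3} (hx : x ≠ 0) (a : Fin 4) :
    |nullCovec c x a| ≤ 1 + 1 / c := by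
  have h : 0 < 1 / c := by positivity
  induction a using Fin.cases with
  | zero => simpa [nullCovec] using h.le
  | succ j =>
    simp only [nullCovec, Fin.cons_succ]
    rw [abs_div, abs_neg, abs_of_pos hc]
    have := div_le_div_of_nonneg_right (abs_direction_le_one hx j) hc.le
    linarith

/-- The size of the derivatives tangential to the outgoing cone at a point. -/
def tangAt (c t : ℝ) (x : E3) (f : SmoothFn) : ℝ :=
  |evalDp c t x f| + 1 / ‖x‖ * rotAt t x f

theorem tangAt_nonneg (c t : ℝ) (x : E3) (f : SmoothFn) : 0 ≤ tangAt c t x f := by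
  have := rotAt_nonneg t x f
  unfold tangAt
  positivity

/-- The gradient is the time derivative times a covector, up to tangential derivatives. -/
theorem abs_dD_sub_le {c : ℝ} (hc : 0 < c) (t : ℝ) {x : E3} (hx : x ≠ 0) (f : SmoothFn)
    (a : Fin 4) :
    |evalS t x (dD a f) - nullCovec c x a * evalS t x (dD 0 f)| ≤
      (1 + 1 / c) * tangAt c t x f := by
  have hc' : 0 < 1 / c := by positivity
  have hr : 0 < ‖x‖ := norm_pos_iff.2 hx
  have hR := rotAt_nonneg t x f
  induction a using Fin.cases with
  | zero =>
    simp only [nullCovec, Fin.cons_zero, one_mul, sub_self, abs_zero]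
    exact mul_nonneg (by positivity) (tangAt_nonneg c t x f)
  | succ j =>
    have hrot (k l : Fin 3) : evalS t x (rotD k l f) =
        x k * evalS t x (dD l.succ f) - x l * evalS t x (dD k.succ f) := rfl
    have hid : evalS t x (dD j.succ f) - nullCovec c x j.succ * evalS t x (dD 0 f) =
        1 / c * (x j / ‖x‖ * evalDp c t x f) +
          1 / ‖x‖ * ∑ k, x k / ‖x‖ * evalS t x (rotD k j f) := by
      have h1 : ∑ k, x k / ‖x‖ * evalS t x (rotD k j f) =
          ‖x‖ * ((∑ k, (x k / ‖x‖) ^ 2) * evalS t x (dD j.succ f) -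
            x j / ‖x‖ * ∑ k, x k / ‖x‖ * evalS t x (dD k.succ f)) := by
        simp only [hrot, Finset.sum_mul, Finset.mul_sum, ← Finset.sum_sub_distrib]
        refine Finset.sum_congr rfl fun k _ => ?_
        field_simp
      rw [h1, sum_sq_direction hx, evalDp_apply]
      simp only [nullCovec, Fin.cons_succ]
      field_simp
      ring
    have hw (k : Fin 3) (y : ℝ) : |x k / ‖x‖ * y| ≤ |y| := by
      rw [abs_mul]
      exact mul_le_of_le_one_left (abs_nonneg _) (abs_direction_le_one hx k)
    have hsum : |∑ k, x k / ‖x‖ * evalS t x (rotD k j f)| ≤ rotAt t x f := by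
      refine ((Finset.abs_sum_le_sum_abs _ _).trans
        (Finset.sum_le_sum fun k _ => hw k _)).trans ?_
      have hsw (k l : Fin 3) : |evalS t x (rotD k l f)| = |evalS t x (rotD l k f)| := by
        rw [hrot, hrot, abs_sub_comm]
      have hself (k : Fin 3) : evalS t x (rotD k k f) = 0 := by rw [hrot, sub_self]
      have h01 := abs_nonneg (evalS t x (rotD 0 1 f))
      have h02 := abs_nonneg (evalS t x (rotD 0 2 f))
      have h12 := abs_nonneg (evalS t x (rotD 1 2 f))
      rw [Fin.sum_univ_three, rotAt]
      fin_cases j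
      · simp only [Fin.zero_eta, hself, hsw 1 0, hsw 2 0, abs_zero]
        linarith
      · simp only [Fin.mk_one, hself, hsw 2 1, abs_zero]
        linarith
      · simp only [Fin.reduceFinMk, hself, abs_zero]
        linarith
    have h1 : |1 / c * (x j / ‖x‖ * evalDp c t x f)| ≤ 1 / c * |evalDp c t x f| := by
      rw [abs_mul, abs_of_pos hc']
      exact mul_le_mul_of_nonneg_left (hw j _) hc'.le
    have h2 : |1 / ‖x‖ * ∑ k, x k / ‖x‖ * evalS t x (rotD k j f)| ≤
        1 / ‖x‖ * rotAt t x f := by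
      rw [abs_mul, abs_of_pos (by positivity : 0 < 1 / ‖x‖)]
      exact mul_le_mul_of_nonneg_left hsum (by positivity)
    rw [hid]
    refine (abs_add_le _ _).trans ((add_le_add h1 h2).trans ?_)
    have h3 : 0 ≤ 1 / ‖x‖ * rotAt t x f := by positivity
    have h4 := abs_nonneg (evalDp c t x f)
    unfold tangAt
    nlinarith [mul_nonneg hc'.le h3]

/-- A product bound for the error terms in the null form estimate. -/
theorem abs_error_le {K T T' P P' E E' p q η : ℝ} (hK : 1 ≤ K) (hE : |E| ≤ K * T)
    (hE' : |E'| ≤ K * T') (hp : |p| ≤ P) (hq : |q| ≤ P') (hη : |η| ≤ K) :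
    |E * q + η * p * E'| ≤ K ^ 2 * (T * P' + P * T') := by
  have h1 : |E * q| ≤ K * T * P' := by
    rw [abs_mul]
    exact mul_le_mul hE hq (abs_nonneg _) ((abs_nonneg _).trans hE)
  have h2 : |η * p * E'| ≤ K * P * (K * T') := by
    rw [abs_mul, abs_mul]
    exact mul_le_mul (mul_le_mul hη hp (abs_nonneg _) ((abs_nonneg _).trans hη)) hE'
      (abs_nonneg _) (mul_nonneg ((abs_nonneg _).trans hη) ((abs_nonneg _).trans hp))
  have h3 : 0 ≤ K * T * P' := (abs_nonneg _).trans h1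
  refine (abs_add_le _ _).trans ((add_le_add h1 h2).trans ?_)
  nlinarith [mul_le_mul_of_nonneg_right hK h3]

theorem exists_nullS_bound {c : ℝ} (hc : 0 < c) (q : Option (Fin 4 × Fin 4)) :
    ∃ C : ℝ, 0 ≤ C ∧ ∀ (v w : SmoothFn) (t : ℝ) (x : E3), x ≠ 0 →
      |evalS t x (nullS c q v w)| ≤
        C * (tangAt c t x v * gradAt t x w + gradAt t x v * tangAt c t x w) := by
  have hK : 1 ≤ 1 + 1 / c := by
    have : 0 < 1 / c := by positivity
    linarith
  have key (v w : SmoothFn) (t : ℝ) (x : E3) (hx : x ≠ 0) (a b : Fin 4) :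
      |evalS t x (dD a v) * evalS t x (dD b w) -
        nullCovec c x a * nullCovec c x b * (evalS t x (dD 0 v) * evalS t x (dD 0 w))| ≤
      (1 + 1 / c) ^ 2 * (tangAt c t x v * gradAt t x w + gradAt t x v * tangAt c t x w) := by
    have := abs_error_le hK (abs_dD_sub_le hc t hx v a) (abs_dD_sub_le hc t hx w b)
      (abs_le_gradAt t x v 0) (abs_le_gradAt t x w b) (abs_nullCovec_le hc hx a)
    convert this using 2
    ring
  rcases q with _ | ⟨a, b⟩
  · refine ⟨(1 + 3 * c ^ 2) * (1 + 1 / c) ^ 2, by positivity, fun v w t x hx => ?_⟩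
    have hid : evalS t x (nullS c none v w) =
        -∑ j : Fin 3, c ^ 2 * (evalS t x (dD j.succ v) * evalS t x (dD j.succ w) -
          nullCovec c x j.succ * nullCovec c x j.succ *
            (evalS t x (dD 0 v) * evalS t x (dD 0 w))) := by
      have h := sum_sq_direction hx
      simp only [nullS, map_sub, evalS_mul, map_smul, map_sum, smul_eq_mul, mul_sub,
        Finset.sum_sub_distrib, ← Finset.mul_sum, ← Finset.sum_mul]
      have h2 : c ^ 2 * ∑ j : Fin 3, nullCovec c x j.succ * nullCovec c x j.succ = 1 := by
        rw [← h, Finset.mul_sum]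
        refine Finset.sum_congr rfl fun j _ => ?_
        simp only [nullCovec, Fin.cons_succ]
        field_simp
      linear_combination (-(evalS t x (dD 0 v) * evalS t x (dD 0 w))) * h2
    rw [hid, abs_neg]
    have hB : 0 ≤ (1 + 1 / c) ^ 2 *
        (tangAt c t x v * gradAt t x w + gradAt t x v * tangAt c t x w) :=
      (abs_nonneg _).trans (key v w t x hx 0 0)
    calc _ ≤ ∑ j : Fin 3, c ^ 2 * ((1 + 1 / c) ^ 2 *
          (tangAt c t x v * gradAt t x w + gradAt t x v * tangAt c t x w)) := by
          refine (Finset.abs_sum_le_sum_abs _ _).trans (Finset.sum_le_sum fun j _ => ?_)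
          rw [abs_mul, abs_of_nonneg (sq_nonneg c)]
          exact mul_le_mul_of_nonneg_left (key v w t x hx _ _) (sq_nonneg c)
      _ ≤ _ := by
          simp only [Finset.sum_const, Finset.card_univ, Fintype.card_fin, nsmul_eq_mul,
            Nat.cast_ofNat]
          nlinarith
  · refine ⟨2 * (1 + 1 / c) ^ 2, by positivity, fun v w t x hx => ?_⟩
    have hid : evalS t x (nullS c (some (a, b)) v w) =
        (evalS t x (dD a v) * evalS t x (dD b w) -
          nullCovec c x a * nullCovec c x b * (evalS t x (dD 0 v) * evalS t x (dD 0 w))) -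
        (evalS t x (dD b v) * evalS t x (dD a w) -
          nullCovec c x b * nullCovec c x a * (evalS t x (dD 0 v) * evalS t x (dD 0 w))) := by
      simp only [nullS, map_sub, evalS_mul]
      ring
    rw [hid]
    refine (abs_sub _ _).trans ?_
    linarith [key v w t x hx a b, key v w t x hx b a]

/-- The norm `|∂v|_n` of a tuple. -/
def gradNorm (n : ℕ) {M : ℕ} (v : Fin M → Fn) (t : ℝ) (x : E3) : ℝ :=
  ∑ i, ∑ a, vnorm n (pda a (v i)) t x

/-- The sum of `|D_{+,c} Z^α v|` over `|α| ≤ n`. -/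
def goodNorm (c : ℝ) (n : ℕ) {M : ℕ} (v : Fin M → Fn) (t : ℝ) (x : E3) : ℝ :=
  ∑ α ∈ multiIdx n, ∑ i, |Dp c (Zpow α (v i)) t x|

/-- The norm `|v|_n` of a tuple. -/
def tupleNorm (n : ℕ) {M : ℕ} (v : Fin M → Fn) (t : ℝ) (x : E3) : ℝ :=
  ∑ i, vnorm n (v i) t x

theorem vnorm_nonneg (n : ℕ) (f : Fn) (t : ℝ) (x : E3) : 0 ≤ vnorm n f t x :=
  Finset.sum_nonneg fun _ _ => abs_nonneg _

theorem gradNorm_nonneg (n : ℕ) {M : ℕ} (v : Fin M → Fn) (t : ℝ) (x : E3) :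
    0 ≤ gradNorm n v t x :=
  Finset.sum_nonneg fun _ _ => Finset.sum_nonneg fun _ _ => vnorm_nonneg _ _ _ _

theorem goodNorm_nonneg (c : ℝ) (n : ℕ) {M : ℕ} (v : Fin M → Fn) (t : ℝ) (x : E3) :
    0 ≤ goodNorm c n v t x :=
  Finset.sum_nonneg fun _ _ => Finset.sum_nonneg fun _ _ => abs_nonneg _

theorem tupleNorm_nonneg (n : ℕ) {M : ℕ} (v : Fin M → Fn) (t : ℝ) (x : E3) :
    0 ≤ tupleNorm n v t x :=
  Finset.sum_nonneg fun _ _ => vnorm_nonneg _ _ _ _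

theorem exists_gradAt_word_le {L : List (Fin 7)} {n : ℕ} (hL : L.length ≤ n) :
    ∃ C : ℝ, 0 ≤ C ∧ ∀ (M : ℕ) (v : Fin M → SmoothFn) (j : Fin M) (t : ℝ) (x : E3),
      gradAt t x (word L (v j)) ≤ C * gradNorm n (fun i => (v i).val) t x := by
  choose C hC hCf using fun a => exists_bound_dD_word a hL
  refine ⟨∑ a, C a, Finset.sum_nonneg fun a _ => hC a, fun M v j t x => ?_⟩
  rw [gradAt, Finset.sum_mul]
  refine Finset.sum_le_sum fun a _ => (hCf a (evalS t x) (v j)).trans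
    (mul_le_mul_of_nonneg_left ?_ (hC a))
  simp only [evalS_apply, coe_ordMono, coe_dD]
  exact Finset.single_le_sum (f := fun i => ∑ a, vnorm n (pda a (v i).val) t x)
    (fun _ _ => Finset.sum_nonneg fun _ _ => vnorm_nonneg _ _ _ _) (Finset.mem_univ j)

theorem exists_abs_evalS_word_le {L : List (Fin 7)} {n : ℕ} (hL : L.length ≤ n) :
    ∃ C : ℝ, 0 ≤ C ∧ ∀ (M : ℕ) (v : Fin M → SmoothFn) (j : Fin M) (t : ℝ) (x : E3),
      |evalS t x (word L (v j))| ≤ C * tupleNorm n (fun i => (v i).val) t x := by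
  obtain ⟨C, hC, hCf⟩ := exists_bound_of_mem_wordSpan (word_mem_wordSpan fieldE hL)
  refine ⟨C, hC, fun M v j t x => (hCf (evalS t x) (v j)).trans
    (mul_le_mul_of_nonneg_left ?_ hC)⟩
  simp only [evalS_apply, coe_ordMono]
  exact Finset.single_le_sum (f := fun i => vnorm n (v i).val t x)
    (fun _ _ => vnorm_nonneg _ _ _ _) (Finset.mem_univ j)

theorem exists_rotAt_word_le {L : List (Fin 7)} {n : ℕ} (hL : L.length ≤ n) :
    ∃ C : ℝ, 0 ≤ C ∧ ∀ (M : ℕ) (v : Fin M → SmoothFn) (j : Fin M) (t : ℝ) (x : E3),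
      rotAt t x (word L (v j)) ≤ C * tupleNorm (n + 1) (fun i => (v i).val) t x := by
  have hi (i : Fin 7) : (i :: L).length ≤ n + 1 := by simpa using hL
  obtain ⟨C₁, h₁, hf₁⟩ := exists_abs_evalS_word_le (hi 4)
  obtain ⟨C₂, h₂, hf₂⟩ := exists_abs_evalS_word_le (hi 5)
  obtain ⟨C₃, h₃, hf₃⟩ := exists_abs_evalS_word_le (hi 6)
  refine ⟨C₁ + C₂ + C₃, by positivity, fun M v j t x => ?_⟩
  have g₁ := hf₁ M v j t x
  have g₂ := hf₂ M v j t x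
  have g₃ := hf₃ M v j t x
  rw [word_cons] at g₁ g₂ g₃
  rw [add_mul, add_mul]
  exact add_le_add (add_le_add g₁ g₂) g₃

theorem exists_evalDp_word_le (c : ℝ) {L : List (Fin 7)} {n : ℕ} (hL : L.length ≤ n) :
    ∃ C : ℝ, 0 ≤ C ∧ ∀ (M : ℕ) (v : Fin M → SmoothFn) (j : Fin M) (t : ℝ) (x : E3),
      |evalDp c t x (word L (v j))| ≤ C * goodNorm c n (fun i => (v i).val) t x := by
  obtain ⟨C, hC, hCf⟩ := exists_bound_of_mem_wordSpan (word_mem_wordSpan fieldE hL)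
  refine ⟨C, hC, fun M v j t x => (hCf (evalDp c t x) (v j)).trans
    (mul_le_mul_of_nonneg_left (Finset.sum_le_sum fun α _ => ?_) hC)⟩
  rw [evalDp_eq_Dp, coe_ordMono]
  exact Finset.single_le_sum (f := fun i => |Dp c (Zpow α (v i).val) t x|)
    (fun _ _ => abs_nonneg _) (Finset.mem_univ j)

theorem exists_tangAt_word_le (c : ℝ) {L : List (Fin 7)} {n : ℕ} (hL : L.length ≤ n) :
    ∃ C : ℝ, 0 ≤ C ∧ ∀ (M : ℕ) (v : Fin M → SmoothFn) (j : Fin M) (t : ℝ) (x : E3),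
      tangAt c t x (word L (v j)) ≤ C * (goodNorm c n (fun i => (v i).val) t x +
        1 / ‖x‖ * tupleNorm (n + 1) (fun i => (v i).val) t x) := by
  obtain ⟨C, hC, hCf⟩ := exists_evalDp_word_le c hL
  obtain ⟨D, hD, hDf⟩ := exists_rotAt_word_le hL
  refine ⟨C + D, add_nonneg hC hD, fun M v j t x => ?_⟩
  have h₁ := hCf M v j t x
  have h₂ := mul_le_mul_of_nonneg_left (hDf M v j t x) (by positivity : 0 ≤ 1 / ‖x‖)
  have h₃ := goodNorm_nonneg c n (fun i => (v i).val) t x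
  have h₄ : 0 ≤ 1 / ‖x‖ * tupleNorm (n + 1) (fun i => (v i).val) t x :=
    mul_nonneg (by positivity) (tupleNorm_nonneg _ _ _ _)
  unfold tangAt
  nlinarith [mul_nonneg hC h₄, mul_nonneg hD h₃]

/-- The right-hand side of the null form estimate. -/
def nullBound (c : ℝ) (s : ℕ) {M : ℕ} (v : Fin M → Fn) (t : ℝ) (x : E3) : ℝ :=
  gradNorm (s / 2) v t x * goodNorm c s v t x + gradNorm s v t x * goodNorm c (s / 2) v t x +
    (1 / ‖x‖) * (gradNorm (s / 2) v t x * tupleNorm (s + 1) v t x +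
      tupleNorm (s / 2 + 1) v t x * gradNorm s v t x)

theorem nullBound_nonneg (c : ℝ) (s : ℕ) {M : ℕ} (v : Fin M → Fn) (t : ℝ) (x : E3) :
    0 ≤ nullBound c s v t x := by
  have h₁ := gradNorm_nonneg s v t x
  have h₂ := gradNorm_nonneg (s / 2) v t x
  have h₃ := goodNorm_nonneg c s v t x
  have h₄ := goodNorm_nonneg c (s / 2) v t x
  have h₅ := tupleNorm_nonneg (s + 1) v t x
  have h₆ := tupleNorm_nonneg (s / 2 + 1) v t x
  unfold nullBound
  exact add_nonneg (add_nonneg (mul_nonneg h₂ h₃) (mul_nonneg h₁ h₄))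
    (mul_nonneg (one_div_nonneg.2 (norm_nonneg x))
      (add_nonneg (mul_nonneg h₂ h₅) (mul_nonneg h₆ h₁)))

theorem exists_tangAt_mul_gradAt_le (c : ℝ) {s : ℕ} {K L : List (Fin 7)}
    (h : K.length + L.length ≤ s) :
    ∃ C : ℝ, 0 ≤ C ∧ ∀ (M : ℕ) (v : Fin M → SmoothFn) (j k : Fin M) (t : ℝ) (x : E3),
      tangAt c t x (word K (v j)) * gradAt t x (word L (v k)) ≤
        C * nullBound c s (fun i => (v i).val) t x := by
  obtain ⟨m, n, hmn, hK, hL⟩ : ∃ m n, ((m = s ∧ n = s / 2) ∨ (m = s / 2 ∧ n = s)) ∧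
      K.length ≤ m ∧ L.length ≤ n := by
    by_cases hK : K.length ≤ s / 2
    · exact ⟨_, _, .inr ⟨rfl, rfl⟩, hK, by omega⟩
    · exact ⟨_, _, .inl ⟨rfl, rfl⟩, by omega, by omega⟩
  obtain ⟨C, hC, hCf⟩ := exists_tangAt_word_le c hK
  obtain ⟨D, hD, hDf⟩ := exists_gradAt_word_le hL
  refine ⟨C * D, mul_nonneg hC hD, fun M v j k t x => ?_⟩
  refine (mul_le_mul (hCf M v j t x) (hDf M v k t x) (gradAt_nonneg _ _ _)
    ((tangAt_nonneg _ _ _ _).trans (hCf M v j t x))).trans ?_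
  rw [mul_mul_mul_comm]
  refine mul_le_mul_of_nonneg_left ?_ (mul_nonneg hC hD)
  set w : Fin M → Fn := fun i => (v i).val
  have h₀ : 0 ≤ 1 / ‖x‖ := by positivity
  have h₁ := gradNorm_nonneg s w t x
  have h₂ := gradNorm_nonneg (s / 2) w t x
  have h₃ := mul_nonneg h₂ (goodNorm_nonneg c s w t x)
  have h₄ := mul_nonneg h₁ (goodNorm_nonneg c (s / 2) w t x)
  have h₅ := mul_nonneg h₀ (mul_nonneg h₂ (tupleNorm_nonneg (s + 1) w t x))
  have h₆ := mul_nonneg h₀ (mul_nonneg (tupleNorm_nonneg (s / 2 + 1) w t x) h₁)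
  unfold nullBound
  rcases hmn with ⟨rfl, rfl⟩ | ⟨rfl, rfl⟩ <;> linarith

theorem exists_word_nullS_le {c : ℝ} (hc : 0 < c) (s : ℕ) (J : List (Fin 7)) :
    ∀ (q : Option (Fin 4 × Fin 4)) (K L : List (Fin 7)), J.length + K.length + L.length ≤ s →
      ∃ C : ℝ, 0 ≤ C ∧ ∀ (M : ℕ) (v : Fin M → SmoothFn) (j k : Fin M) (t : ℝ) (x : E3), x ≠ 0 →
        |evalS t x (word J (nullS c q (word K (v j)) (word L (v k))))| ≤
          C * nullBound c s (fun i => (v i).val) t x := by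
  induction J using List.reverseRecOn with
  | nil =>
    intro q K L h
    simp only [List.length_nil, Nat.zero_add] at h
    obtain ⟨C, hC, hCf⟩ := exists_nullS_bound hc q
    obtain ⟨D, hD, hDf⟩ := exists_tangAt_mul_gradAt_le c h
    obtain ⟨E, hE, hEf⟩ := exists_tangAt_mul_gradAt_le c ((add_comm _ _).trans_le h)
    refine ⟨C * (D + E), by positivity, fun M v j k t x hx => ?_⟩
    refine (hCf _ _ t x hx).trans ?_
    rw [mul_assoc, add_mul, mul_comm (gradAt t x _)]
    exact mul_le_mul_of_nonneg_left (add_le_add (hDf M v j k t x) (hEf M v k j t x)) hC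
  | append_singleton J i ih =>
    intro q K L h
    simp only [List.length_append, List.length_singleton] at h
    obtain ⟨m, hm⟩ := exists_fieldD_nullS c i q
    obtain ⟨C, hC, hCf⟩ := ih q (i :: K) L (by simp only [List.length_cons]; omega)
    obtain ⟨D, hD, hDf⟩ := ih q K (i :: L) (by simp only [List.length_cons]; omega)
    choose E hE hEf using fun p => ih (some p) K L (by omega)
    refine ⟨C + D + ∑ p, |m p| * E p, by
      have : 0 ≤ ∑ p, |m p| * E p :=
        Finset.sum_nonneg fun p _ => mul_nonneg (abs_nonneg _) (hE p)
      positivity, fun M v j k t x hx => ?_⟩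
    rw [word_concat, hm]
    simp only [map_add, map_sum, map_smul, ← word_cons, smul_eq_mul]
    rw [add_mul, add_mul, Finset.sum_mul]
    refine (abs_add_le _ _).trans (add_le_add ((abs_add_le _ _).trans
      (add_le_add (hCf M v j k t x hx) (hDf M v j k t x hx)))
      ((Finset.abs_sum_le_sum_abs _ _).trans (Finset.sum_le_sum fun p _ => ?_)))
    rw [abs_mul, mul_assoc]
    exact mul_le_mul_of_nonneg_left (hEf p M v j k t x hx) (abs_nonneg _)

theorem exists_vnorm_nullS_le {c : ℝ} (hc : 0 < c) (s : ℕ) (q : Option (Fin 4 × Fin 4)) :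
    ∃ C : ℝ, 0 < C ∧ ∀ (M : ℕ) (v : Fin M → SmoothFn) (j k : Fin M) (t : ℝ) (x : E3), x ≠ 0 →
      vnorm s (nullS c q (v j) (v k)).val t x ≤
        C * nullBound c s (fun i => (v i).val) t x := by
  have hα (α : Fin 7 → ℕ) : ∃ C : ℝ, 0 ≤ C ∧ (α ∈ multiIdx s →
      ∀ (M : ℕ) (v : Fin M → SmoothFn) (j k : Fin M) (t : ℝ) (x : E3), x ≠ 0 →
        |Zpow α (nullS c q (v j) (v k)).val t x| ≤
          C * nullBound c s (fun i => (v i).val) t x) := by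
    by_cases h : α ∈ multiIdx s
    · obtain ⟨C, hC, hCf⟩ := exists_word_nullS_le hc s (ordList α) q [] []
        (by simpa [length_ordList] using mem_multiIdx.1 h)
      refine ⟨C, hC, fun _ M v j k t x hx => ?_⟩
      rw [← coe_ordMono, ← prod_map_ordList]
      exact hCf M v j k t x hx
    · exact ⟨0, le_rfl, fun h' => absurd h' h⟩
  choose C hC hCf using hα
  refine ⟨∑ α ∈ multiIdx s, C α + 1,
    add_pos_of_nonneg_of_pos (Finset.sum_nonneg fun α _ => hC α) one_pos,
    fun M v j k t x hx => ?_⟩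
  rw [add_mul, Finset.sum_mul, one_mul]
  exact (Finset.sum_le_sum fun α h => hCf α h M v j k t x hx).trans
    (le_add_of_nonneg_right (nullBound_nonneg c s _ t x))

theorem stmt6 (c : ℝ) (hc : 0 < c) (Q : Fn → Fn → Fn)
    (hQ : Q = Q0f c ∨ ∃ a b : Fin 4, a < b ∧ Q = Qab a b) (s : ℕ) :
    ∃ C > (0 : ℝ), ∀ M : ℕ, 1 ≤ M → ∀ v : Fin M → Fn, (∀ i, Smooth (v i)) →
      ∀ (j k : Fin M) (t : ℝ) (x : E3), 0 < t → x ≠ 0 →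
        vnorm s (Q (v j) (v k)) t x ≤
          C * ((∑ i, ∑ a, vnorm (s / 2) (pda a (v i)) t x) *
                (∑ α ∈ multiIdx s, ∑ i, |Dp c (Zpow α (v i)) t x|) +
              (∑ i, ∑ a, vnorm s (pda a (v i)) t x) *
                (∑ α ∈ multiIdx (s / 2), ∑ i, |Dp c (Zpow α (v i)) t x|) +
              (1 / ‖x‖) *
                ((∑ i, ∑ a, vnorm (s / 2) (pda a (v i)) t x) *
                    (∑ i, vnorm (s + 1) (v i) t x) +
                  (∑ i, vnorm (s / 2 + 1) (v i) t x) *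
                    (∑ i, ∑ a, vnorm s (pda a (v i)) t x))) := by
  obtain ⟨q, hq⟩ : ∃ q, ∀ f g : SmoothFn, Q f.val g.val = (nullS c q f g).val := by
    rcases hQ with rfl | ⟨a, b, -, rfl⟩
    · refine ⟨none, fun f g => funext fun t => funext fun x => ?_⟩
      change _ = evalS t x (nullS c none f g)
      simp only [nullS, map_sub, map_smul, map_sum]
      rfl
    · exact ⟨some (a, b), fun f g => rfl⟩
  obtain ⟨C, hC, hCf⟩ := exists_vnorm_nullS_le hc s q
  refine ⟨C, hC, fun M _ v hv j k t x _ hx => ?_⟩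
  have h := hCf M (fun i => SmoothFn.mk (v i) (hv i)) j k t x hx
  rw [← hq] at h
  exact h

end PaperKatayama
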